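/- Assume ρ̂(A,B) < ∞ and let y be a minimal weakly optimal vector with exactly m positive coordinates. Then y is a weak generalized Perron–Frobenius eigenvector, i.e., A y = ρ̂(A,B) B y. Moreover, if A', B' ∈ ℝ^{m×m} denote the submatrices of A and B formed by the columns indexed by the support of y, then rank(A' − ρ̂(A,B) B') = m − 1. -/

import Mathlib

open Matrix
open scoped ENNReal

/-- `r(A,B,x) = inf{t ∈ [0,∞] : A x ≤ t B x entrywise}`, valued in `ℝ≥0∞`
(the infimum of the empty set being `⊤`). -/
noncomputable def cwR {m n : ℕ} (A B : Matrix (Fin m) (Fin n) ℝ) (x : Fin n → ℝ) : ℝ≥0∞ :=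
  sInf {t : ℝ≥0∞ | ∃ s : ℝ, 0 ≤ s ∧ t = ENNReal.ofReal s ∧
    ∀ i, A.mulVec x i ≤ s * B.mulVec x i}

/-- The weak Collatz–Wielandt quotient `ρ̂(A,B) = inf{r(A,B,x) : x ≥ 0, x ≠ 0}`. -/
noncomputable def cwRhoHat {m n : ℕ} (A B : Matrix (Fin m) (Fin n) ℝ) : ℝ≥0∞ :=
  sInf {t : ℝ≥0∞ | ∃ x : Fin n → ℝ, (∀ j, 0 ≤ x j) ∧ x ≠ 0 ∧ t = cwR A B x}

/-- The support of a vector: the set of indices of its positive coordinates. -/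
def suppS {n : ℕ} (y : Fin n → ℝ) : Set (Fin n) := {j | 0 < y j}

/-- `y` is weakly optimal for the pair `(A,B)`. -/
def WeaklyOptimal {m n : ℕ} (A B : Matrix (Fin m) (Fin n) ℝ) (y : Fin n → ℝ) : Prop :=
  (∀ j, 0 ≤ y j) ∧ y ≠ 0 ∧ cwR A B y = cwRhoHat A B

/-- `y` is minimal weakly optimal: weakly optimal, and no weakly optimal vector has
support strictly contained in the support of `y`. -/
def MinWeaklyOptimal {m n : ℕ} (A B : Matrix (Fin m) (Fin n) ℝ) (y : Fin n → ℝ) : Prop :=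
  WeaklyOptimal A B y ∧ ∀ w : Fin n → ℝ, WeaklyOptimal A B w → ¬ suppS w ⊂ suppS y

lemma mulVec_apply_nonneg {m n : ℕ} {A : Matrix (Fin m) (Fin n) ℝ} (hA : ∀ i j, 0 ≤ A i j)
    {x : Fin n → ℝ} (hx : ∀ j, 0 ≤ x j) (i : Fin m) : 0 ≤ A.mulVec x i := by
  rw [mulVec, dotProduct]
  exact Finset.sum_nonneg fun j _ => mul_nonneg (hA i j) (hx j)

lemma mulVec_le_of_cwR_lt_top {m n : ℕ} {A B : Matrix (Fin m) (Fin n) ℝ}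
    (hB : ∀ i j, 0 ≤ B i j) {x : Fin n → ℝ} (hx : ∀ j, 0 ≤ x j) (h : cwR A B x < ⊤) (i : Fin m) :
    A.mulVec x i ≤ (cwR A B x).toReal * B.mulVec x i := by
  have hBx : 0 ≤ B.mulVec x i := mulVec_apply_nonneg hB hx i
  have key : ∀ s, (cwR A B x).toReal < s → A.mulVec x i ≤ s * B.mulVec x i := by
    intro s hs
    have hs' : cwR A B x < ENNReal.ofReal s := (ENNReal.lt_ofReal_iff_toReal_lt h.ne).2 hs
    obtain ⟨_, ⟨r, hr, rfl, hle⟩, hlt⟩ := sInf_lt_iff.1 hs'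
    have hrs : r ≤ s := (ENNReal.ofReal_lt_ofReal_iff_of_nonneg hr).1 hlt |>.le
    exact (hle i).trans (mul_le_mul_of_nonneg_right hrs hBx)
  rcases hBx.eq_or_lt with h0 | hpos
  · simpa [← h0] using key _ (lt_add_one _)
  · rw [← div_le_iff₀ hpos]
    exact le_of_forall_gt_imp_ge_of_dense fun s hs => (div_le_iff₀ hpos).2 (key s hs)

lemma cwR_le_of_mulVec_le {m n : ℕ} {A B : Matrix (Fin m) (Fin n) ℝ} {x : Fin n → ℝ} {s : ℝ}
    (hs : 0 ≤ s) (h : ∀ i, A.mulVec x i ≤ s * B.mulVec x i) :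
    cwR A B x ≤ ENNReal.ofReal s :=
  sInf_le ⟨s, hs, rfl, h⟩

lemma cwRhoHat_le_cwR {m n : ℕ} {A B : Matrix (Fin m) (Fin n) ℝ} {x : Fin n → ℝ}
    (hx : ∀ j, 0 ≤ x j) (hx0 : x ≠ 0) : cwRhoHat A B ≤ cwR A B x :=
  sInf_le ⟨x, hx, hx0, rfl⟩

lemma weaklyOptimal_of_mulVec_le {m n : ℕ} {A B : Matrix (Fin m) (Fin n) ℝ}
    (hfin : cwRhoHat A B < ⊤) {x : Fin n → ℝ} (hx : ∀ j, 0 ≤ x j) (hx0 : x ≠ 0)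
    (h : ∀ i, A.mulVec x i ≤ (cwRhoHat A B).toReal * B.mulVec x i) : WeaklyOptimal A B x := by
  refine ⟨hx, hx0, le_antisymm ?_ (cwRhoHat_le_cwR hx hx0)⟩
  simpa [ENNReal.ofReal_toReal hfin.ne] using cwR_le_of_mulVec_le ENNReal.toReal_nonneg h

lemma not_forall_mulVec_lt {m n : ℕ} (hm : 0 < m) {A B : Matrix (Fin m) (Fin n) ℝ}
    (hA : ∀ i j, 0 ≤ A i j) (hB : ∀ i j, 0 ≤ B i j)
    {x : Fin n → ℝ} (hx : ∀ j, 0 ≤ x j) (hx0 : x ≠ 0) :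
    ¬ ∀ i, A.mulVec x i < (cwRhoHat A B).toReal * B.mulVec x i := by
  intro h
  have hAx (i) : 0 ≤ A.mulVec x i := mulVec_apply_nonneg hA hx i
  have hBx (i) : 0 ≤ B.mulVec x i := mulVec_apply_nonneg hB hx i
  have hpos (i) : 0 < B.mulVec x i :=
    (hBx i).lt_of_ne fun h0 => by
      have hi := h i
      rw [← h0, mul_zero] at hi
      exact (hAx i).not_gt hi
  have : Nonempty (Fin m) := ⟨⟨0, hm⟩⟩
  obtain ⟨k, hk⟩ := Finite.exists_max fun i => A.mulVec x i / B.mulVec x i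
  have hle := (cwRhoHat_le_cwR (A := A) (B := B) hx hx0).trans
    (cwR_le_of_mulVec_le (div_nonneg (hAx k) (hBx k)) fun i => (div_le_iff₀ (hpos i)).1 (hk i))
  have hle' := ENNReal.toReal_mono ENNReal.ofReal_ne_top hle
  rw [ENNReal.toReal_ofReal (div_nonneg (hAx k) (hBx k)), le_div_iff₀ (hpos k)] at hle'
  exact (h k).not_ge hle'

/-- A vector of the kernel of `A - ρ̂(A,B) B` supported in the support of a minimal weakly
optimal vector `y` is proportional to `y`. -/
lemma MinWeaklyOptimal.exists_eq_smul {m n : ℕ} {A B : Matrix (Fin m) (Fin n) ℝ}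
    (hB : ∀ i j, 0 ≤ B i j) (hfin : cwRhoHat A B < ⊤) {y : Fin n → ℝ}
    (hy : MinWeaklyOptimal A B y) {z : Fin n → ℝ} (hz0 : z ≠ 0) (hzy : ∀ j, z j ≠ 0 → 0 < y j)
    (hz : A.mulVec z = (cwRhoHat A B).toReal • B.mulVec z) : ∃ c : ℝ, y = c • z := by
  wlog hpos : ∃ j, 0 < z j generalizing z
  · obtain ⟨j, hj⟩ := Function.ne_iff.1 hz0
    have hneg : 0 < (-z) j :=
      neg_pos.2 (lt_of_le_of_ne (not_lt.1 fun h => hpos ⟨j, h⟩) hj)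
    obtain ⟨c, hc⟩ := this (z := -z) (neg_ne_zero.2 hz0) (fun j h => hzy j (neg_ne_zero.1 h))
      (by simp [mulVec_neg, hz]) ⟨j, hneg⟩
    exact ⟨-c, by simpa using hc⟩
  obtain ⟨⟨hy0, hyne, hyopt⟩, hmin⟩ := hy
  obtain ⟨j₀, hj₀⟩ := hpos
  obtain ⟨k, hk, hkmin⟩ := Finset.exists_min_image (Finset.univ.filter fun j => 0 < z j)
    (fun j => y j / z j) ⟨j₀, by simpa using hj₀⟩
  simp only [Finset.mem_filter, Finset.mem_univ, true_and] at hk hkmin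
  set t := y k / z k
  have ht : 0 ≤ t := div_nonneg (hy0 k) hk.le
  refine ⟨t, by_contra fun hne => ?_⟩
  have hw0 (j) : 0 ≤ (y - t • z) j := by
    simp only [Pi.sub_apply, Pi.smul_apply, smul_eq_mul, sub_nonneg]
    rcases lt_or_ge 0 (z j) with h | h
    · exact (le_div_iff₀ h).1 (hkmin j h)
    · exact (mul_nonpos_of_nonneg_of_nonpos ht h).trans (hy0 j)
  have hle := mulVec_le_of_cwR_lt_top (A := A) hB hy0 (hyopt ▸ hfin)
  refine hmin (y - t • z) (weaklyOptimal_of_mulVec_le hfin hw0 (sub_ne_zero.2 hne) fun i => ?_)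
    (Set.ssubset_iff_of_subset ?_ |>.2 ⟨k, hzy k hk.ne', ?_⟩)
  · have h1 := hle i
    have h2 := congrFun hz i
    rw [hyopt] at h1
    simp only [mulVec_sub, mulVec_smul, Pi.sub_apply, Pi.smul_apply, smul_eq_mul] at h2 ⊢
    rw [h2]
    linarith
  · intro j hj
    by_contra hyj
    have h1 : z j = 0 := by_contra fun h => hyj (hzy j h)
    exact hyj (by simpa [suppS, h1] using hj)
  · simp [suppS, t, div_mul_cancel₀ _ hk.ne']

lemma mulVec_extend_zero {m n k : ℕ} (D : Matrix (Fin m) (Fin n) ℝ) {e : Fin k → Fin n}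
    (he : Function.Injective e) (z : Fin k → ℝ) :
    D.mulVec (Function.extend e z 0) = (D.submatrix id e).mulVec z := by
  ext i
  simp only [mulVec, dotProduct, submatrix_apply, id]
  rw [← Finset.sum_subset (Finset.subset_univ (Finset.univ.map ⟨e, he⟩))]
  · simp [he.extend_apply]
  · intro j _ hj
    rw [Function.extend_apply' _ _ _ (by simpa using hj)]
    simp

lemma MinWeaklyOptimal.eigenvector_and_rank {m n : ℕ} (hm : 0 < m)
    {A B : Matrix (Fin m) (Fin n) ℝ}
    (hA : ∀ i j, 0 ≤ A i j) (hB : ∀ i j, 0 ≤ B i j) (hfin : cwRhoHat A B < ⊤)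
    {y : Fin n → ℝ} (hy : MinWeaklyOptimal A B y) {e : Fin m → Fin n}
    (he : Function.Injective e) (hrange : Set.range e = suppS y) :
    A.mulVec y = (cwRhoHat A B).toReal • B.mulVec y ∧
      ((A - (cwRhoHat A B).toReal • B).submatrix id e).rank = m - 1 := by
  set ρ := (cwRhoHat A B).toReal
  set D := A - ρ • B
  set C := D.submatrix id e
  obtain ⟨hy0, hyne, hyopt⟩ := hy.1
  have hD (x) : D.mulVec x = A.mulVec x - ρ • B.mulVec x := by
    simp [D, sub_mulVec, smul_mulVec]
  have hpos (k) : 0 < y (e k) := by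
    have : e k ∈ suppS y := hrange ▸ Set.mem_range_self k
    exact this
  have hyext : Function.extend e (y ∘ e) 0 = y := by
    ext j
    by_cases hj : ∃ k, e k = j
    · obtain ⟨k, rfl⟩ := hj
      simp [he.extend_apply]
    · rw [Function.extend_apply' _ _ _ hj]
      have : j ∉ suppS y := hrange ▸ hj
      exact le_antisymm (hy0 j) (not_lt.1 this)
  have hCle (i) : C.mulVec (y ∘ e) i ≤ 0 := by
    have h1 := mulVec_le_of_cwR_lt_top (A := A) hB hy0 (hyopt ▸ hfin) i
    rw [hyopt] at h1
    rw [← mulVec_extend_zero D he, hyext, hD]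
    simpa using h1
  have hker (z : Fin m → ℝ) (hz0 : z ≠ 0) (hz : C.mulVec z = 0) : ∃ c : ℝ, y ∘ e = c • z := by
    have hz' := mulVec_extend_zero D he z
    rw [hD] at hz'
    obtain ⟨c, hc⟩ := hy.exists_eq_smul hB hfin (z := Function.extend e z 0)
      (fun h => hz0 (funext fun k => by simpa [he.extend_apply] using congrFun h (e k)))
      (fun j hj => by
        by_contra hyj
        refine hj (Function.extend_apply' _ _ _ fun ⟨k, hk⟩ => hyj (hk ▸ hpos k)))
      (sub_eq_zero.1 (hz'.trans hz))
    exact ⟨c, funext fun k => by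
      simpa [he.extend_apply] using congrFun hc (e k)⟩
  have hdet : C.det = 0 := by
    by_contra hdet
    have hu : IsUnit C.det := isUnit_iff_ne_zero.2 hdet
    obtain ⟨z, hz⟩ : ∃ z, C.mulVec z = fun _ => -1 :=
      ⟨C⁻¹.mulVec fun _ => -1, by rw [mulVec_mulVec, mul_nonsing_inv _ hu, one_mulVec]⟩
    obtain ⟨ε, hε, hεpos⟩ : ∃ ε > 0, ∀ k, 0 < y (e k) + ε * z k := by
      have : ∀ᶠ ε in nhdsWithin (0 : ℝ) (Set.Ioi 0), ∀ k, 0 < y (e k) + ε * z k := by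
        refine Filter.eventually_all.2 fun k => nhdsWithin_le_nhds ?_
        have hc : ContinuousAt (fun ε : ℝ => y (e k) + ε * z k) 0 := by fun_prop
        exact hc.eventually_const_lt (by simpa using hpos k)
      obtain ⟨ε, h1, h2⟩ := (this.and self_mem_nhdsWithin).exists
      exact ⟨ε, h2, h1⟩
    set x := Function.extend e (y ∘ e + ε • z) 0
    have hxe (k) : x (e k) = y (e k) + ε * z k := by simp [x, he.extend_apply]
    refine not_forall_mulVec_lt hm hA hB (x := x) (fun j => ?_) (fun h => ?_) fun i => ?_
    · by_cases hj : ∃ k, e k = j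
      · obtain ⟨k, rfl⟩ := hj
        exact hxe k ▸ (hεpos k).le
      · have hxj : x j = 0 := Function.extend_apply' _ _ _ hj
        exact hxj.ge
    · exact (hεpos ⟨0, hm⟩).ne' (hxe ⟨0, hm⟩ ▸ congrFun h _)
    · have h1 := congrFun (mulVec_extend_zero D he (y ∘ e + ε • z)) i
      have h2 := hCle i
      have h3 := congrFun hz i
      change D.mulVec x i = C.mulVec _ i at h1
      rw [hD, mulVec_add, mulVec_smul] at h1
      simp only [Pi.sub_apply, Pi.add_apply, Pi.smul_apply, smul_eq_mul, h3] at h1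
      change _ < ρ * _
      linarith
  obtain ⟨z, hz0, hz⟩ := exists_mulVec_eq_zero_iff.2 hdet
  have hCy : C.mulVec (y ∘ e) = 0 := by
    obtain ⟨c, hc⟩ := hker z hz0 hz
    rw [hc, mulVec_smul, hz, smul_zero]
  refine ⟨?_, ?_⟩
  · rw [← sub_eq_zero, ← hD]
    rw [← mulVec_extend_zero D he, hyext] at hCy
    exact hCy
  · have hye : y ∘ e ≠ 0 := fun h => (hpos ⟨0, hm⟩).ne' (congrFun h _)
    have hone : Module.finrank ℝ (LinearMap.ker C.mulVecLin) = 1 := by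
      refine finrank_eq_one_iff'.2 ⟨⟨y ∘ e, hCy⟩, fun h => hye (congrArg Subtype.val h), fun ⟨w, hw⟩ => ?_⟩
      by_cases hw0 : w = 0
      · exact ⟨0, Subtype.ext (by simp [hw0])⟩
      · obtain ⟨c, hc⟩ := hker w hw0 hw
        have hc0 : c ≠ 0 := fun h => hye (by rw [hc, h, zero_smul])
        exact ⟨c⁻¹, Subtype.ext (by simp [hc, smul_smul, inv_mul_cancel₀ hc0])⟩
    have := LinearMap.finrank_range_add_finrank_ker C.mulVecLin
    rw [hone, Module.finrank_fin_fun] at this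
    rw [rank]
    omega

/-- A minimal weakly optimal vector `y` with exactly `m` positive coordinates is a weak
GPF-eigenvector, `A y = ρ̂(A,B) B y`, and for the submatrices `A', B'` formed by the
columns in the support of `y` (enumerated by any injection `e : Fin m → Fin n` onto the
support) one has `rank (A' - ρ̂(A,B) B') = m - 1`. -/
theorem stmt13 {m n : ℕ} (hm : 0 < m) (hn : 0 < n)
    (A B : Matrix (Fin m) (Fin n) ℝ)
    (hA : ∀ i j, 0 ≤ A i j) (hB : ∀ i j, 0 ≤ B i j)
    (hfin : cwRhoHat A B < ⊤)
    (y : Fin n → ℝ) (hy : MinWeaklyOptimal A B y)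
    (hcard : (suppS y).ncard = m) :
    A.mulVec y = (cwRhoHat A B).toReal • B.mulVec y ∧
    ∀ e : Fin m → Fin n, Function.Injective e → (∀ k, e k ∈ suppS y) →
      (Matrix.of fun i k => A i (e k) - (cwRhoHat A B).toReal * B i (e k)).rank
        = m - 1 := by
  have hrange (e : Fin m → Fin n) (he : Function.Injective e) (hmem : ∀ k, e k ∈ suppS y) :
      Set.range e = suppS y := by
    refine Set.eq_of_subset_of_ncard_le (Set.range_subset_iff.2 hmem) ?_ (Set.toFinite _)
    rw [hcard, ← Set.image_univ, Set.ncard_image_of_injective _ he, Set.ncard_univ]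
    simp
  refine ⟨?_, fun e he hmem =>
    (hy.eigenvector_and_rank hm hA hB hfin he (hrange e he hmem)).2⟩
  let f : Fin m ≃ suppS y := (Finite.equivFinOfCardEq hcard).symm
  have hf : Function.Injective fun k => (f k : Fin n) := Subtype.val_injective.comp f.injective
  exact (hy.eigenvector_and_rank hm hA hB hfin hf (hrange _ hf fun k => (f k).2)).1
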